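/- (Quantitative form of Proposition 2) |I(X;Y) − I(X;Y|Z)| ≤ max(I(Y;Z), I(Y;Z|X)); hence if both the leaked information I(S;c) and the compensating term I(c;S|x̂) are small, the conditional mutual information I(c;x̂|S) measured by the benchmark approximates the true mutual information I(x̂;c). -/

import Mathlib

open Real

variable {A B C : Type*}

/-- Entropy of the X-marginal of a joint pmf on `A × B × C`. -/
noncomputable def Hx [Fintype A] [Fintype B] [Fintype C] (p : A × B × C → ℝ) : ℝ :=
  ∑ a, negMulLog (∑ b, ∑ c, p (a, b, c))

/-- Entropy of the Y-marginal. -/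
noncomputable def Hy [Fintype A] [Fintype B] [Fintype C] (p : A × B × C → ℝ) : ℝ :=
  ∑ b, negMulLog (∑ a, ∑ c, p (a, b, c))

/-- Entropy of the Z-marginal. -/
noncomputable def Hz [Fintype A] [Fintype B] [Fintype C] (p : A × B × C → ℝ) : ℝ :=
  ∑ c, negMulLog (∑ a, ∑ b, p (a, b, c))

/-- Entropy of the (X,Y)-marginal. -/
noncomputable def Hxy [Fintype A] [Fintype B] [Fintype C] (p : A × B × C → ℝ) : ℝ :=
  ∑ a, ∑ b, negMulLog (∑ c, p (a, b, c))

/-- Entropy of the (X,Z)-marginal. -/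
noncomputable def Hxz [Fintype A] [Fintype B] [Fintype C] (p : A × B × C → ℝ) : ℝ :=
  ∑ a, ∑ c, negMulLog (∑ b, p (a, b, c))

/-- Entropy of the (Y,Z)-marginal. -/
noncomputable def Hyz [Fintype A] [Fintype B] [Fintype C] (p : A × B × C → ℝ) : ℝ :=
  ∑ b, ∑ c, negMulLog (∑ a, p (a, b, c))

/-- Entropy of the full joint distribution. -/
noncomputable def Hxyz [Fintype A] [Fintype B] [Fintype C] (p : A × B × C → ℝ) : ℝ :=
  ∑ a, ∑ b, ∑ c, negMulLog (p (a, b, c))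

/-- Mutual information `I(X;Y) = H(X) + H(Y) − H(XY)`. -/
noncomputable def Ixy [Fintype A] [Fintype B] [Fintype C] (p : A × B × C → ℝ) : ℝ :=
  Hx p + Hy p - Hxy p

/-- Mutual information `I(X;Z) = H(X) + H(Z) − H(XZ)`. -/
noncomputable def Ixz [Fintype A] [Fintype B] [Fintype C] (p : A × B × C → ℝ) : ℝ :=
  Hx p + Hz p - Hxz p

/-- Mutual information `I(Y;Z) = H(Y) + H(Z) − H(YZ)`. -/
noncomputable def Iyz [Fintype A] [Fintype B] [Fintype C] (p : A × B × C → ℝ) : ℝ :=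
  Hy p + Hz p - Hyz p

/-- Joint mutual information `I(X;(Y,Z)) = H(X) + H(YZ) − H(XYZ)`. -/
noncomputable def IxYZ [Fintype A] [Fintype B] [Fintype C] (p : A × B × C → ℝ) : ℝ :=
  Hx p + Hyz p - Hxyz p

/-- Conditional mutual information `I(X;Y|Z) = H(XZ) + H(YZ) − H(Z) − H(XYZ)`. -/
noncomputable def IxyGz [Fintype A] [Fintype B] [Fintype C] (p : A × B × C → ℝ) : ℝ :=
  Hxz p + Hyz p - Hz p - Hxyz p

/-- Conditional mutual information `I(X;Z|Y) = H(XY) + H(YZ) − H(Y) − H(XYZ)`. -/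
noncomputable def IxzGy [Fintype A] [Fintype B] [Fintype C] (p : A × B × C → ℝ) : ℝ :=
  Hxy p + Hyz p - Hy p - Hxyz p

/-- Conditional mutual information `I(Y;Z|X) = H(XY) + H(XZ) − H(X) − H(XYZ)`. -/
noncomputable def IyzGx [Fintype A] [Fintype B] [Fintype C] (p : A × B × C → ℝ) : ℝ :=
  Hxy p + Hxz p - Hx p - Hxyz p

theorem aux_point (f r s t : ℝ) (hf : 0 ≤ f) (hr : f ≤ r) (hs : f ≤ s) (ht : f ≤ t) :
    f - r * s / t ≤ f * log f - f * log r - f * log s + f * log t := by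
  rcases hf.eq_or_lt with h | h
  · subst h
    have : 0 ≤ r * s / t := by positivity
    simp only [zero_mul]
    linarith
  · have hr' : 0 < r := by linarith
    have hs' : 0 < s := by linarith
    have ht' : 0 < t := by linarith
    have h1 : log (r * s / (t * f)) ≤ r * s / (t * f) - 1 :=
      log_le_sub_one_of_pos (by positivity)
    rw [log_div (by positivity) (by positivity), log_mul hr'.ne' hs'.ne',
      log_mul ht'.ne' h.ne'] at h1
    have h2 := mul_le_mul_of_nonneg_left h1 h.le
    have h3 : f * (r * s / (t * f) - 1) = r * s / t - f := by
      field_simp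
    rw [h3] at h2
    linarith

theorem aux_sub {B C : Type*} [Fintype B] [Fintype C] (f : B → C → ℝ) (hf : ∀ b c, 0 ≤ f b c) :
    negMulLog (∑ b, ∑ c, f b c) + ∑ b, ∑ c, negMulLog (f b c) ≤
      ∑ b, negMulLog (∑ c, f b c) + ∑ c, negMulLog (∑ b, f b c) := by
  have hr : ∀ b c, f b c ≤ ∑ c, f b c := fun b c =>
    Finset.single_le_sum (f := fun c => f b c) (fun c _ => hf b c) (Finset.mem_univ c)
  have hs : ∀ b c, f b c ≤ ∑ b, f b c := fun b c =>
    Finset.single_le_sum (f := fun b => f b c) (fun b _ => hf b c) (Finset.mem_univ b)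
  have ht : ∀ b c, f b c ≤ ∑ b, ∑ c, f b c := fun b c => (hr b c).trans
    (Finset.single_le_sum (f := fun b => ∑ c, f b c)
      (fun b _ => Finset.sum_nonneg fun c _ => hf b c) (Finset.mem_univ b))
  have key := Finset.sum_le_sum fun b (_ : b ∈ Finset.univ) =>
    Finset.sum_le_sum fun c (_ : c ∈ Finset.univ) =>
      aux_point (f b c) _ _ _ (hf b c) (hr b c) (hs b c) (ht b c)
  have e : ∑ c, ∑ b, f b c = ∑ b, ∑ c, f b c := Finset.sum_comm
  have e2 : ∑ b, ∑ c, f b c * log (∑ b, f b c) = ∑ c, (∑ b, f b c) * log (∑ b, f b c) := by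
    rw [Finset.sum_comm]
    simp only [Finset.sum_mul]
  simp only [Finset.sum_add_distrib, Finset.sum_sub_distrib, e2] at key
  simp only [← Finset.sum_mul, ← Finset.mul_sum, ← Finset.sum_div, e] at key
  rw [mul_self_div_self] at key
  simp only [negMulLog, neg_mul, Finset.sum_neg_distrib]
  linarith

/-- **Quantitative form of Proposition 2:**
`|I(X;Y) − I(X;Y|Z)| ≤ max (I(Y;Z)) (I(Y;Z|X))`.  Hence if both the leaked
information `I(S;c)` and the compensating term `I(c;S|x̂)` are small, the conditional
mutual information `I(c;x̂|S)` measured by the benchmark approximates the true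
mutual information `I(x̂;c)`. -/
theorem prop2_quantitative
    [Fintype A] [Fintype B] [Fintype C] [Nonempty A] [Nonempty B] [Nonempty C]
    (p : A × B × C → ℝ) (hp : ∀ ω, 0 ≤ p ω) (hsum : ∑ ω, p ω = 1) :
    |Ixy p - IxyGz p| ≤ max (Iyz p) (IyzGx p) := by
  have h1 : 0 ≤ IyzGx p := by
    have := Finset.sum_le_sum fun a (_ : a ∈ Finset.univ) =>
      aux_sub (fun b c => p (a, b, c)) (fun b c => hp _)
    simp only [Finset.sum_add_distrib] at this
    simp only [IyzGx, Hxy, Hxz, Hx, Hxyz]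
    linarith
  have h2 : 0 ≤ Iyz p := by
    have := aux_sub (fun b c => ∑ a, p (a, b, c)) (fun b c => Finset.sum_nonneg fun a _ => hp _)
    have e : ∑ b, ∑ c, ∑ a, p (a, b, c) = 1 := by
      rw [← hsum]
      simp only [Fintype.sum_prod_type]
      rw [Finset.sum_comm (f := fun a b => ∑ c, p (a, b, c))]
      exact Finset.sum_congr rfl fun b _ => Finset.sum_comm
    have e1 : ∀ b, ∑ c, ∑ a, p (a, b, c) = ∑ a, ∑ c, p (a, b, c) := fun b => Finset.sum_comm
    have e2 : ∀ c, ∑ b, ∑ a, p (a, b, c) = ∑ a, ∑ b, p (a, b, c) := fun c => Finset.sum_comm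
    rw [e, negMulLog_one] at this
    simp only [e1, e2] at this
    simp only [Iyz, Hy, Hz, Hyz]
    linarith
  have h3 : Ixy p - IxyGz p = Iyz p - IyzGx p := by
    simp only [Ixy, IxyGz, Iyz, IyzGx]
    ring
  rw [h3, abs_le]
  constructor
  · have := le_max_right (Iyz p) (IyzGx p)
    linarith
  · have := le_max_left (Iyz p) (IyzGx p)
    linarith
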